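/- arXiv:2509.18343 — 9 statements merged into one kernel-verified Lean document; each statement's English description precedes it below -/
import Mathlib

section
/- Let û : ℝ → ℝ be differentiable, let S ≥ 0, and define g : (0,∞) → ℝ by g(c) = û((√c + S)²) − c. If c₀ > 0 is a stationary point of g (in particular, if c₀ is an interior local maximum of g), then û'(F) = √c₀ / (√c₀ + S), where F = (√c₀ + S)². That is, an agent contributing c₀ to best-respond under Quadratic Funding, with the other agents' square-rooted contributions summing to S, satisfies the first-order condition û'(F^QF) = √c₀ / Σ_j √c_j. -/
/-- First-order condition for a best response under Quadratic Funding: if `uhat` is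
differentiable, `S ≥ 0`, and `c₀ > 0` is a stationary point of
`g c = uhat ((√c + S)²) − c`, then `uhat' ((√c₀ + S)²) = √c₀ / (√c₀ + S)`. -/
theorem qf_best_response_first_order_condition
    (uhat : ℝ → ℝ) (huhat : Differentiable ℝ uhat) (S : ℝ) (hS : 0 ≤ S)
    (c₀ : ℝ) (hc₀ : 0 < c₀)
    (hstat : deriv (fun c : ℝ => uhat ((Real.sqrt c + S) ^ 2) - c) c₀ = 0) :
    deriv uhat ((Real.sqrt c₀ + S) ^ 2) = Real.sqrt c₀ / (Real.sqrt c₀ + S) := by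
  have hs : 0 < Real.sqrt c₀ := Real.sqrt_pos.mpr hc₀
  have h1 : HasDerivAt (fun c : ℝ => (Real.sqrt c + S) ^ 2)
      ((2 : ℕ) * (Real.sqrt c₀ + S) ^ (2 - 1) * (1 / (2 * Real.sqrt c₀))) c₀ :=
    ((Real.hasDerivAt_sqrt hc₀.ne').add_const S).pow 2
  have h2 : HasDerivAt (fun c : ℝ => uhat ((Real.sqrt c + S) ^ 2) - c)
      (deriv uhat ((Real.sqrt c₀ + S) ^ 2) *
        ((2 : ℕ) * (Real.sqrt c₀ + S) ^ (2 - 1) * (1 / (2 * Real.sqrt c₀))) - 1) c₀ :=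
    (HasDerivAt.comp c₀ (huhat ((Real.sqrt c₀ + S) ^ 2)).hasDerivAt h1).sub (hasDerivAt_id c₀)
  rw [h2.deriv] at hstat
  have hp : 0 < Real.sqrt c₀ + S := by linarith
  generalize deriv uhat ((Real.sqrt c₀ + S) ^ 2) = d at hstat ⊢
  rw [eq_div_iff hp.ne']
  norm_num at hstat
  field_simp at hstat
  linarith
end

section
/- Suppose every contribution c_i > 0, every sympathy coefficient satisfies α_{ij} ≥ 0 and α_{ii} = 1, there exist agents p ≠ q with α_{pq} > 0, every u_j is differentiable with u_j' > 0 everywhere, and for every agent i the equilibrium first-order condition Σ_{j=1}^n α_{ij} u_j'(F^QF) = √c_i / (Σ_{j=1}^n √c_j) holds, where F^QF = (Σ_{j=1}^n √c_j)². Then Σ_{i=1}^n u_i'(F^QF) < 1, and consequently F^QF does not maximize utilitarian social welfare: there exists F̃ ∈ [0, ∞) with USW(F̃) > USW(F^QF). -/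
open Finset

/-- In the presence of prosocial utilities (some `α p q > 0` with `p ≠ q`), if every agent's
equilibrium first-order condition holds at `F^QF = (∑ j √(c j))²`, then the sum of personal
marginal utilities at `F^QF` is strictly less than 1, and consequently `F^QF` does not maximize
utilitarian social welfare `USW(F) = ∑ i, u i F − F` over `[0, ∞)`. -/
theorem qf_not_welfare_maximizing_with_prosocial_utilities
    (n : ℕ) (c : Fin n → ℝ) (hc : ∀ i, 0 < c i)
    (α : Fin n → Fin n → ℝ) (hα : ∀ i j, 0 ≤ α i j) (hαii : ∀ i, α i i = 1)
    (p q : Fin n) (hpq : p ≠ q) (hαpq : 0 < α p q)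
    (u : Fin n → ℝ → ℝ) (hu : ∀ j, Differentiable ℝ (u j))
    (hu' : ∀ j x, 0 < deriv (u j) x)
    (hFOC : ∀ i, ∑ j, α i j * deriv (u j) ((∑ k, Real.sqrt (c k)) ^ 2)
      = Real.sqrt (c i) / ∑ j, Real.sqrt (c j)) :
    (∑ i, deriv (u i) ((∑ k, Real.sqrt (c k)) ^ 2) < 1) ∧
    ∃ F ∈ Set.Ici (0 : ℝ),
      ((∑ i, u i ((∑ k, Real.sqrt (c k)) ^ 2)) - (∑ k, Real.sqrt (c k)) ^ 2)
        < (∑ i, u i F) - F := by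
  have hS : 0 < ∑ k, Real.sqrt (c k) :=
    Finset.sum_pos (fun i _ => Real.sqrt_pos.mpr (hc i)) ⟨p, Finset.mem_univ p⟩
  have hF : 0 < (∑ k, Real.sqrt (c k)) ^ 2 := by positivity
  have htot : ∑ i, Real.sqrt (c i) / ∑ j, Real.sqrt (c j) = 1 := by
    rw [← Finset.sum_div]
    exact div_self hS.ne'
  generalize (∑ k, Real.sqrt (c k)) ^ 2 = F₀ at *
  have hnn : ∀ i j, 0 ≤ α i j * deriv (u j) F₀ :=
    fun i j => mul_nonneg (hα i j) (hu' j F₀).le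
  have hlt : ∑ i, deriv (u i) F₀ < 1 := by
    rw [← htot]
    apply Finset.sum_lt_sum
    · intro i _
      rw [← hFOC i]
      have h := Finset.single_le_sum (f := fun j => α i j * deriv (u j) F₀)
        (fun j _ => hnn i j) (Finset.mem_univ i)
      simpa [hαii i] using h
    · refine ⟨p, Finset.mem_univ p, ?_⟩
      rw [← hFOC p]
      have h := Finset.single_lt_sum (f := fun j => α p j * deriv (u j) F₀) (i := p) (j := q)
        hpq.symm (Finset.mem_univ p) (Finset.mem_univ q)
        (mul_pos hαpq (hu' q F₀)) (fun j _ _ => hnn p j)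
      simpa [hαii p] using h
  refine ⟨hlt, ?_⟩
  by_contra! hcon
  have hmax : IsLocalMax (fun F => (∑ i, u i F) - F) F₀ := by
    filter_upwards [Ioi_mem_nhds hF] with x hx
    exact hcon x (Set.mem_Ici.mpr (le_of_lt (Set.mem_Ioi.mp hx)))
  have hd : HasDerivAt (fun F => (∑ i, u i F) - F) ((∑ i, deriv (u i) F₀) - 1) F₀ :=
    (HasDerivAt.fun_sum (fun i _ => (hu i F₀).hasDerivAt)).sub (hasDerivAt_id F₀)
  have h0 := hmax.hasDerivAt_eq_zero hd
  linarith
end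

section
/- Under the hypotheses that every c_i > 0, α_{ij} ≥ 0 with α_{ii} = 1, there exist p ≠ q with α_{pq} > 0, every u_j is differentiable, strictly concave, and satisfies u_j' > 0, and the equilibrium first-order conditions Σ_{j=1}^n α_{ij} u_j'(F^QF) = √c_i / (Σ_{j=1}^n √c_j) hold for all i at F^QF = (Σ_{j=1}^n √c_j)²: if F* ∈ [0, ∞) maximizes utilitarian social welfare USW over [0, ∞), then F* < F^QF. That is, in the presence of prosocial utilities Quadratic Funding overshoots the welfare-optimal funding level. -/
open Finset

/-- In the presence of prosocial utilities, Quadratic Funding overshoots the welfare-optimal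
funding level: if `F*` maximizes utilitarian social welfare `USW(F) = ∑ i, u i F − F` over
`[0, ∞)`, then `F* < F^QF` where `F^QF = (∑ j √(c j))²`. -/
theorem qf_overshoots_welfare_optimum_with_prosocial_utilities
    (n : ℕ) (c : Fin n → ℝ) (hc : ∀ i, 0 < c i)
    (α : Fin n → Fin n → ℝ) (hα : ∀ i j, 0 ≤ α i j) (hαii : ∀ i, α i i = 1)
    (p q : Fin n) (hpq : p ≠ q) (hαpq : 0 < α p q)
    (u : Fin n → ℝ → ℝ) (hu : ∀ j, Differentiable ℝ (u j))
    (hconc : ∀ j, StrictConcaveOn ℝ Set.univ (u j))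
    (hu' : ∀ j x, 0 < deriv (u j) x)
    (hFOC : ∀ i, ∑ j, α i j * deriv (u j) ((∑ k, Real.sqrt (c k)) ^ 2)
      = Real.sqrt (c i) / ∑ j, Real.sqrt (c j))
    (Fstar : ℝ) (hFstar : Fstar ∈ Set.Ici (0 : ℝ))
    (hmax : ∀ F ∈ Set.Ici (0 : ℝ), (∑ i, u i F) - F ≤ (∑ i, u i Fstar) - Fstar) :
    Fstar < (∑ k, Real.sqrt (c k)) ^ 2 := by
  have hS : 0 < ∑ k, Real.sqrt (c k) :=
    Finset.sum_pos (fun i _ => Real.sqrt_pos.2 (hc i)) ⟨p, Finset.mem_univ p⟩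
  set S := ∑ k, Real.sqrt (c k) with hSdef
  have hG : 0 < S ^ 2 := by positivity
  by_contra hlt
  have hle : S ^ 2 ≤ Fstar := not_lt.1 hlt
  have hFpos : 0 < Fstar := lt_of_lt_of_le hG hle
  -- first-order condition at the interior maximizer
  have hder : HasDerivAt (fun F => (∑ i, u i F) - F) ((∑ i, deriv (u i) Fstar) - 1) Fstar :=
    (HasDerivAt.fun_sum (fun i _ => (hu i Fstar).hasDerivAt)).sub (hasDerivAt_id' Fstar)
  have hloc : IsLocalMax (fun F => (∑ i, u i F) - F) Fstar := by
    filter_upwards [Ici_mem_nhds hFpos] with F hF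
    exact hmax F hF
  have h0 := hloc.hasDerivAt_eq_zero hder
  -- the derivatives are antitone
  have hanti : ∑ i, deriv (u i) Fstar ≤ ∑ i, deriv (u i) (S ^ 2) := by
    refine Finset.sum_le_sum fun i _ => ?_
    exact (hconc i).concaveOn.antitoneOn_deriv (fun x _ => (hu i x))
      (Set.mem_univ _) (Set.mem_univ _) hle
  -- sum of the equilibrium conditions
  have hsum : ∑ i, ∑ j, α i j * deriv (u j) (S ^ 2) = 1 := by
    rw [Finset.sum_congr rfl (fun i _ => hFOC i), ← Finset.sum_div, ← hSdef, div_self hS.ne']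
  have hterm : ∀ i, ∀ j ∈ Finset.univ, 0 ≤ α i j * deriv (u j) (S ^ 2) :=
    fun i j _ => mul_nonneg (hα i j) (hu' j _).le
  have hstrict : ∑ i, deriv (u i) (S ^ 2) < ∑ i, ∑ j, α i j * deriv (u j) (S ^ 2) := by
    refine Finset.sum_lt_sum (fun i _ => ?_) ⟨p, Finset.mem_univ p, ?_⟩
    · have := Finset.single_le_sum (hterm i) (Finset.mem_univ i)
      simpa [hαii i] using this
    · have := Finset.single_lt_sum (f := fun j => α p j * deriv (u j) (S ^ 2)) hpq.symm
        (Finset.mem_univ p) (Finset.mem_univ q)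
        (mul_pos hαpq (hu' q _)) (fun j hj _ => hterm p j hj)
      simpa [hαii p] using this
  linarith
end

section
/- Suppose agents are selfish, i.e., α_{ii} = 1 and α_{ij} = 0 for all i ≠ j, every c_i > 0, every u_i is differentiable and concave, and for every agent i the equilibrium first-order condition u_i'(F^QF) = √c_i / (Σ_{j=1}^n √c_j) holds at F^QF = (Σ_{j=1}^n √c_j)². Then Σ_{i=1}^n u_i'(F^QF) = 1, and F^QF maximizes utilitarian social welfare USW(F) = Σ_{i=1}^n u_i(F) − F over F ∈ [0, ∞). -/
open Finset

/-- Tangent line inequality for a differentiable concave function. -/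
theorem concave_tangent (f : ℝ → ℝ) (hf : Differentiable ℝ f) (hc : ConcaveOn ℝ Set.univ f)
    (a x : ℝ) : f x ≤ f a + deriv f a * (x - a) := by
  rcases lt_trichotomy x a with h | h | h
  · have := hc.le_slope_of_hasDerivAt (Set.mem_univ x) (Set.mem_univ a) h (hf a).hasDerivAt
    rw [slope_def_field, le_div_iff₀ (by linarith)] at this
    linarith
  · subst h; simp
  · have := hc.slope_le_of_hasDerivAt (Set.mem_univ a) (Set.mem_univ x) h (hf a).hasDerivAt
    rw [slope_def_field, div_le_iff₀ (by linarith)] at this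
    linarith

/-- With selfish agents (`α i i = 1`, `α i j = 0` for `i ≠ j`), if every agent's equilibrium
first-order condition `u_i'(F^QF) = √(c i) / ∑ j √(c j)` holds at `F^QF = (∑ j √(c j))²`, then
the personal marginal utilities sum to 1 at `F^QF`, and `F^QF` maximizes utilitarian social
welfare `USW(F) = ∑ i, u i F − F` over `[0, ∞)`. -/
theorem qf_welfare_maximizing_with_selfish_agents
    (n : ℕ) (hn : 0 < n) (c : Fin n → ℝ) (hc : ∀ i, 0 < c i)
    (α : Fin n → Fin n → ℝ) (hαii : ∀ i, α i i = 1) (hαij : ∀ i j, i ≠ j → α i j = 0)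
    (u : Fin n → ℝ → ℝ) (hu : ∀ i, Differentiable ℝ (u i))
    (hconc : ∀ i, ConcaveOn ℝ Set.univ (u i))
    (hFOC : ∀ i, deriv (u i) ((∑ k, Real.sqrt (c k)) ^ 2)
      = Real.sqrt (c i) / ∑ j, Real.sqrt (c j)) :
    (∑ i, deriv (u i) ((∑ k, Real.sqrt (c k)) ^ 2) = 1) ∧
    ∀ F ∈ Set.Ici (0 : ℝ),
      (∑ i, u i F) - F
        ≤ (∑ i, u i ((∑ k, Real.sqrt (c k)) ^ 2)) - (∑ k, Real.sqrt (c k)) ^ 2 := by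
  have hne : (Finset.univ : Finset (Fin n)).Nonempty := ⟨⟨0, hn⟩, Finset.mem_univ _⟩
  have hS : 0 < ∑ j, Real.sqrt (c j) :=
    Finset.sum_pos (fun i _ => Real.sqrt_pos.mpr (hc i)) hne
  have h1 : ∑ i, deriv (u i) ((∑ k, Real.sqrt (c k)) ^ 2) = 1 := by
    rw [Finset.sum_congr rfl (fun i _ => hFOC i), ← Finset.sum_div, div_self hS.ne']
  refine ⟨h1, fun F _ => ?_⟩
  have h2 := Finset.sum_le_sum (s := Finset.univ) (fun i _ =>
    concave_tangent (u i) (hu i) (hconc i) ((∑ k, Real.sqrt (c k)) ^ 2) F)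
  rw [Finset.sum_add_distrib, ← Finset.sum_mul, h1] at h2
  linarith
end

section
/- If the set of social groups consists of all singletons, G = { {i} : i ∈ N }, then the original Connection-Oriented Quadratic Funding amount equals the Quadratic Funding amount: F^CO-QF' = Σ_{i∈N} c_i + Σ_{(g,h), g≠h} √( (Σ_{i∈g} c_i^{1/k_{i,h}} / |T_i|) · (Σ_{j∈h} c_j^{1/k_{j,g}} / |T_j|) ) = (Σ_{i∈N} √c_i)². -/
open Finset

/-- `Tset G i` is the set of groups in `G` containing agent `i`. -/
def Tset {N : Type*} [DecidableEq N] (G : Finset (Finset N)) (i : N) : Finset (Finset N) :=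
  G.filter (fun g => i ∈ g)

/-- The connection coefficient `k_{i,h}`: it is 1 if `T_i ∩ ⋃_{j ∈ h} T_j = ∅` and 2
otherwise. -/
def kcoef {N : Type*} [DecidableEq N] (G : Finset (Finset N)) (i : N) (h : Finset N) : ℕ :=
  if Tset G i ∩ h.biUnion (Tset G) = ∅ then 1 else 2

/-- The original CO-QF funding amount
`F^CO-QF' = ∑ i c i + ∑_{(g,h) ∈ G×G, g ≠ h} √((∑_{i∈g} c_i^{1/k_{i,h}}/|T_i|) ·
(∑_{j∈h} c_j^{1/k_{j,g}}/|T_j|))`. -/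
noncomputable def coqfOrig {N : Type*} [Fintype N] [DecidableEq N]
    (G : Finset (Finset N)) (c : N → ℝ) : ℝ :=
  (∑ i, c i) +
    ∑ g ∈ G, ∑ h ∈ G,
      if g ≠ h then
        Real.sqrt ((∑ i ∈ g, c i ^ ((1 : ℝ) / (kcoef G i h : ℝ)) / (Tset G i).card) *
                   (∑ j ∈ h, c j ^ ((1 : ℝ) / (kcoef G j g : ℝ)) / (Tset G j).card))
      else 0

/-- When the set of social groups consists of all singletons `{ {i} : i ∈ N }`, the original
Connection-Oriented Quadratic Funding amount equals the Quadratic Funding amount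
`(∑ i √(c i))²`. -/
theorem coqfOrig_singleton_groups_eq_qf
    (N : Type*) [Fintype N] [DecidableEq N] (c : N → ℝ) (hc : ∀ i, 0 ≤ c i) :
    coqfOrig (Finset.univ.image (fun i : N => ({i} : Finset N))) c
      = (∑ i, Real.sqrt (c i)) ^ 2 := by
  have hT : ∀ i : N, Tset (Finset.univ.image (fun i : N => ({i} : Finset N))) i = {{i}} := by
    intro i
    ext g
    simp only [Tset, Finset.mem_filter, Finset.mem_image, Finset.mem_univ, true_and,
      Finset.mem_singleton]
    constructor
    · rintro ⟨⟨j, rfl⟩, h⟩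
      rw [Finset.mem_singleton.1 h]
    · rintro rfl
      exact ⟨⟨i, rfl⟩, Finset.mem_singleton_self i⟩
  have hk : ∀ i j : N, i ≠ j →
      kcoef (Finset.univ.image (fun i : N => ({i} : Finset N))) i {j} = 1 := by
    intro i j hij
    unfold kcoef
    rw [Finset.singleton_biUnion, hT, hT, if_pos]
    ext g
    simp only [Finset.mem_inter, Finset.mem_singleton, Finset.notMem_empty, iff_false]
    rintro ⟨rfl, h⟩
    exact hij (Finset.singleton_injective h)
  unfold coqfOrig
  rw [Finset.sum_image (fun a _ b _ h => Finset.singleton_injective h)]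
  rw [sq, Finset.sum_mul_sum, ← Finset.sum_add_distrib]
  refine Finset.sum_congr rfl fun i _ => ?_
  rw [Finset.sum_image (fun a _ b _ h => Finset.singleton_injective h)]
  rw [← Finset.add_sum_erase _ _ (Finset.mem_univ i),
    ← Finset.add_sum_erase Finset.univ (fun j => Real.sqrt (c i) * Real.sqrt (c j))
      (Finset.mem_univ i)]
  rw [if_neg (by simp), zero_add, Real.mul_self_sqrt (hc i)]
  congr 1
  refine Finset.sum_congr rfl fun j hj => ?_
  have hji : j ≠ i := (Finset.mem_erase.1 hj).1
  rw [if_pos (fun h => hji (Finset.singleton_injective h).symm)]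
  rw [Finset.sum_singleton, Finset.sum_singleton, hk i j hji.symm, hk j i hji, hT, hT]
  simp [Real.sqrt_mul (hc i)]
end

section
/- Let N be a finite set of agents with contributions c_i ≥ 0 and let g ⊆ N be a subset with |g| ≥ 2. If every member of g increases their contribution by x ≥ 0 (i.e., contributions become c_i + x for i ∈ g and c_i for i ∉ g), then the Quadratic Funding subsidy of the new contribution profile is at least (|g|² − |g|) · x. In particular, the QF subsidy grows at least linearly in a coordinated group contribution increase. -/
open Finset

/-- If every member of a group `g` with `|g| ≥ 2` increases their contribution by `x ≥ 0`, then
the Quadratic Funding subsidy of the new contribution profile is at least `(|g|² − |g|) · x`: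
the QF subsidy grows at least linearly in a coordinated group contribution increase. -/
theorem qf_subsidy_linear_in_group_contribution
    (N : Type*) [Fintype N] [DecidableEq N]
    (c : N → ℝ) (hc : ∀ i, 0 ≤ c i)
    (g : Finset N) (hg : 2 ≤ g.card)
    (x : ℝ) (hx : 0 ≤ x) :
    ((g.card : ℝ) ^ 2 - g.card) * x
      ≤ (∑ i, Real.sqrt (if i ∈ g then c i + x else c i)) ^ 2
          - ∑ i, (if i ∈ g then c i + x else c i) := by
  set d : N → ℝ := fun i => if i ∈ g then c i + x else c i with hd
  have hd0 : ∀ i, 0 ≤ d i := by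
    intro i
    have := hc i
    simp only [hd]
    split_ifs <;> linarith
  set s : N → ℝ := fun i => Real.sqrt (d i) with hs
  have hs0 : ∀ i, 0 ≤ s i := fun i => Real.sqrt_nonneg _
  have hsg : ∀ i ∈ g, Real.sqrt x ≤ s i := by
    intro i hi
    apply Real.sqrt_le_sqrt
    have := hc i
    simp only [hd, if_pos hi]
    linarith
  have hsq : ∀ i, d i = s i * s i := fun i => (Real.mul_self_sqrt (hd0 i)).symm
  have hrest : ∀ i, 0 ≤ (∑ j, s j) - s i := by
    intro i
    have := Finset.single_le_sum (f := s) (fun j _ => hs0 j) (Finset.mem_univ i)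
    linarith
  have hrestg : ∀ i ∈ g, ((g.card : ℝ) - 1) * Real.sqrt x ≤ (∑ j, s j) - s i := by
    intro i hi
    have h1 : ∑ j ∈ g.erase i, s j ≤ ∑ j ∈ Finset.univ.erase i, s j :=
      Finset.sum_le_sum_of_subset_of_nonneg
        (Finset.erase_subset_erase _ (Finset.subset_univ g)) (fun j _ _ => hs0 j)
    have h2 : (g.erase i).card • Real.sqrt x ≤ ∑ j ∈ g.erase i, s j :=
      Finset.card_nsmul_le_sum _ _ _ (fun j hj => hsg j (Finset.mem_of_mem_erase hj))
    have h3 := Finset.add_sum_erase Finset.univ s (Finset.mem_univ i)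
    rw [nsmul_eq_mul, Finset.card_erase_of_mem hi, Nat.cast_sub (by omega), Nat.cast_one] at h2
    linarith
  have hk : (2 : ℝ) ≤ g.card := by exact_mod_cast hg
  have key : (∑ i, s i) ^ 2 - ∑ i, d i = ∑ i, s i * ((∑ j, s j) - s i) := by
    simp only [mul_sub, Finset.sum_sub_distrib, ← Finset.sum_mul, hsq, sq]
  change _ ≤ (∑ i, s i) ^ 2 - ∑ i, d i
  rw [key]
  have hA : g.card • (Real.sqrt x * (((g.card : ℝ) - 1) * Real.sqrt x))
      ≤ ∑ i ∈ g, s i * ((∑ j, s j) - s i) := by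
    apply Finset.card_nsmul_le_sum
    intro i hi
    exact mul_le_mul (hsg i hi) (hrestg i hi)
      (mul_nonneg (by linarith) (Real.sqrt_nonneg _)) (hs0 i)
  have hB : ∑ i ∈ g, s i * ((∑ j, s j) - s i) ≤ ∑ i, s i * ((∑ j, s j) - s i) :=
    Finset.sum_le_sum_of_subset_of_nonneg (Finset.subset_univ g)
      (fun i _ _ => mul_nonneg (hs0 i) (hrest i))
  refine le_trans (le_of_eq ?_) (hA.trans hB)
  rw [nsmul_eq_mul]
  nth_rewrite 1 [← Real.mul_self_sqrt hx]
  ring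
end

section
/- Fix a finite set N of agents, a collection G of social groups covering N, an agent i ∈ N, and contributions c_j ≥ 0 for all j ≠ i. Then there exist constants A ≥ 0 and B ≥ 0 (depending only on N, G, and the fixed contributions) such that for every x ≥ 0, the CO-QF' subsidy of the profile in which agent i contributes x and each other agent contributes c_j is at most A + B·√x. That is, the original Connection-Oriented Quadratic Funding subsidy grows as O(√x) in any single agent's contribution (Property 1 of the desiderata). -/
open Finset

/-- The original CO-QF subsidy
`∑_{(g,h) ∈ G×G, g ≠ h} √((∑_{i∈g} c_i^{1/k_{i,h}}/|T_i|) · (∑_{j∈h} c_j^{1/k_{j,g}}/|T_j|))`. -/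
noncomputable def coqfOrigSubsidy {N : Type*} [DecidableEq N]
    (G : Finset (Finset N)) (c : N → ℝ) : ℝ :=
  ∑ g ∈ G, ∑ h ∈ G,
    if g ≠ h then
      Real.sqrt ((∑ i ∈ g, c i ^ ((1 : ℝ) / (kcoef G i h : ℝ)) / (Tset G i).card) *
                 (∑ j ∈ h, c j ^ ((1 : ℝ) / (kcoef G j g : ℝ)) / (Tset G j).card))
    else 0

lemma coqf_factor_bound {N : Type*} [DecidableEq N] (G : Finset (Finset N)) (i : N) (c : N → ℝ)
    (hc : ∀ j, j ≠ i → 0 ≤ c j) (g h : Finset N) :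
    ∃ a : ℝ, 0 ≤ a ∧ ∀ x : ℝ, 0 ≤ x → ∀ F : ℝ,
      F = (∑ j ∈ g, (if j = i then x else c j) ^ ((1 : ℝ) / (kcoef G j h : ℝ)) /
        (Tset G j).card) →
      0 ≤ F ∧ F ≤ a + x ∧ (i ∉ g → F ≤ a) ∧ (kcoef G i h = 2 → F ≤ a + Real.sqrt x) := by
  have hnn : 0 ≤ ∑ j ∈ g.erase i, c j ^ ((1 : ℝ) / (kcoef G j h : ℝ)) / (Tset G j).card := by
    refine Finset.sum_nonneg fun j hj => ?_
    have := hc j (Finset.ne_of_mem_erase hj)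
    positivity
  refine ⟨1 + ∑ j ∈ g.erase i, c j ^ ((1 : ℝ) / (kcoef G j h : ℝ)) / (Tset G j).card,
    by positivity, ?_⟩
  intro x hx F hF
  have hs := Real.sqrt_nonneg x
  have hsum : ∑ j ∈ g.erase i, (if j = i then x else c j) ^ ((1 : ℝ) / (kcoef G j h : ℝ)) /
      (Tset G j).card = ∑ j ∈ g.erase i, c j ^ ((1 : ℝ) / (kcoef G j h : ℝ)) /
      (Tset G j).card := by
    refine Finset.sum_congr rfl fun j hj => ?_
    rw [if_neg (Finset.ne_of_mem_erase hj)]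
  by_cases hi : i ∈ g
  · rw [← Finset.add_sum_erase _ _ hi, hsum, if_pos rfl] at hF
    have hp : 0 ≤ x ^ ((1 : ℝ) / (kcoef G i h : ℝ)) := by positivity
    have hdiv : x ^ ((1 : ℝ) / (kcoef G i h : ℝ)) / (Tset G i).card
        ≤ x ^ ((1 : ℝ) / (kcoef G i h : ℝ)) := by
      rcases Nat.eq_zero_or_pos (Tset G i).card with h0 | h0
      · rw [h0]; simpa using hp
      · exact div_le_self hp (by exact_mod_cast h0)
    have hdn : 0 ≤ x ^ ((1 : ℝ) / (kcoef G i h : ℝ)) / (Tset G i).card := by positivity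
    have hk : kcoef G i h = 1 ∨ kcoef G i h = 2 := by
      unfold kcoef; split_ifs <;> simp
    have h2 : kcoef G i h = 2 → x ^ ((1 : ℝ) / (kcoef G i h : ℝ)) = Real.sqrt x := by
      intro h; rw [h, Real.sqrt_eq_rpow]; norm_num
    have hsx : Real.sqrt x ≤ 1 + x := by
      nlinarith [Real.sq_sqrt hx, sq_nonneg (Real.sqrt x - 1)]
    have h1 : x ^ ((1 : ℝ) / (kcoef G i h : ℝ)) ≤ 1 + x := by
      rcases hk with h | h
      · rw [h]; norm_num
      · rw [h2 h]; exact hsx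
    refine ⟨by linarith, by linarith, fun h => absurd hi h, fun h => ?_⟩
    rw [h2 h] at hdiv h1 hF
    linarith
  · have he : g.erase i = g := Finset.erase_eq_of_notMem hi
    rw [he] at hsum hnn ⊢
    rw [hsum] at hF
    exact ⟨by linarith, by linarith, fun _ => by linarith, fun _ => by linarith⟩

lemma coqf_sqrt_mul_bound {a b x F H : ℝ} (ha : 0 ≤ a) (hb : 0 ≤ b) (hx : 0 ≤ x)
    (hH : 0 ≤ H) (h1 : F ≤ a) (h2 : H ≤ b + x) :
    Real.sqrt (F * H) ≤ Real.sqrt (a * b) + Real.sqrt a * Real.sqrt x := by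
  rw [← Real.sqrt_mul ha]
  calc Real.sqrt (F * H) ≤ Real.sqrt (a * b + a * x) :=
        Real.sqrt_le_sqrt (by nlinarith [mul_le_mul h1 h2 hH ha])
    _ ≤ _ := by
        have e1 : 0 ≤ a * b := by positivity
        have e2 : 0 ≤ a * x := by positivity
        rw [Real.sqrt_le_left (by positivity)]
        nlinarith [Real.sq_sqrt e1, Real.sq_sqrt e2,
          mul_nonneg (Real.sqrt_nonneg (a * b)) (Real.sqrt_nonneg (a * x))]

lemma coqf_kcoef_eq_two {N : Type*} [DecidableEq N] {G : Finset (Finset N)} {i : N}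
    {h : Finset N} (hh : h ∈ G) (hi : i ∈ h) : kcoef G i h = 2 := by
  unfold kcoef
  rw [if_neg]
  apply Finset.Nonempty.ne_empty
  have hm : h ∈ Tset G i := by simp [Tset, hh, hi]
  exact ⟨h, Finset.mem_inter.2 ⟨hm, Finset.mem_biUnion.2 ⟨i, hi, hm⟩⟩⟩

lemma coqf_pair_bound {N : Type*} [DecidableEq N] (G : Finset (Finset N)) (i : N) (c : N → ℝ)
    (hc : ∀ j, j ≠ i → 0 ≤ c j) (g h : Finset N) :
    ∃ A B : ℝ, 0 ≤ A ∧ 0 ≤ B ∧ (g ∈ G → h ∈ G → ∀ x : ℝ, 0 ≤ x →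
      (if g ≠ h then
        Real.sqrt ((∑ j ∈ g, (if j = i then x else c j) ^ ((1 : ℝ) / (kcoef G j h : ℝ)) /
            (Tset G j).card) *
          (∑ j ∈ h, (if j = i then x else c j) ^ ((1 : ℝ) / (kcoef G j g : ℝ)) /
            (Tset G j).card))
      else 0) ≤ A + B * Real.sqrt x) := by
  obtain ⟨a, ha, hF⟩ := coqf_factor_bound G i c hc g h
  obtain ⟨b, hb, hH⟩ := coqf_factor_bound G i c hc h g
  refine ⟨Real.sqrt (a * b) + (a + b), Real.sqrt a + Real.sqrt b + 1, by positivity,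
    by positivity, ?_⟩
  intro hg hh x hx
  have p1 := Real.sqrt_nonneg (a * b)
  have p2 := mul_nonneg (Real.sqrt_nonneg a) (Real.sqrt_nonneg x)
  have p3 := mul_nonneg (Real.sqrt_nonneg b) (Real.sqrt_nonneg x)
  have p4 := Real.sqrt_nonneg x
  split_ifs
  · obtain ⟨f0, f1, f2, f3⟩ := hF x hx _ rfl
    obtain ⟨k0, k1, k2, k3⟩ := hH x hx _ rfl
    generalize (∑ j ∈ g, (if j = i then x else c j) ^ ((1 : ℝ) / (kcoef G j h : ℝ)) /
            (Tset G j).card) = F at *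
    generalize (∑ j ∈ h, (if j = i then x else c j) ^ ((1 : ℝ) / (kcoef G j g : ℝ)) /
            (Tset G j).card) = H at *
    by_cases ig : i ∈ g
    · by_cases ih : i ∈ h
      · have q1 := f3 (coqf_kcoef_eq_two hh ih)
        have q2 := k3 (coqf_kcoef_eq_two hg ig)
        have : Real.sqrt (F * H) ≤ a + b + Real.sqrt x := by
          rw [Real.sqrt_le_left (by positivity), sq]
          exact mul_le_mul (by linarith) (by linarith) k0 (by positivity)
        linarith
      · have := coqf_sqrt_mul_bound hb ha hx f0 (k2 ih) f1
        rw [mul_comm H F, mul_comm b a] at this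
        linarith
    · have := coqf_sqrt_mul_bound ha hb hx k0 (f2 ig) k1
      linarith
  · linarith

/-- Property 1 of the desiderata: fixing all other contributions, the original CO-QF subsidy of
the profile in which agent `i` contributes `x` is bounded by `A + B·√x` for constants
`A, B ≥ 0`, i.e. it grows as `O(√x)` in any single agent's contribution. -/
theorem coqfOrig_subsidy_sqrt_in_single_contribution
    (N : Type*) [Fintype N] [DecidableEq N]
    (G : Finset (Finset N)) (hGne : ∀ g ∈ G, g.Nonempty)
    (hcover : ∀ i : N, ∃ g ∈ G, i ∈ g)
    (i : N) (c : N → ℝ) (hc : ∀ j, j ≠ i → 0 ≤ c j) :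
    ∃ A B : ℝ, 0 ≤ A ∧ 0 ≤ B ∧
      ∀ x : ℝ, 0 ≤ x →
        coqfOrigSubsidy G (fun j => if j = i then x else c j) ≤ A + B * Real.sqrt x := by
  choose A B hA hB hAB using fun g h => coqf_pair_bound G i c hc g h
  refine ⟨∑ g ∈ G, ∑ h ∈ G, A g h, ∑ g ∈ G, ∑ h ∈ G, B g h,
    Finset.sum_nonneg fun g _ => Finset.sum_nonneg fun h _ => hA g h,
    Finset.sum_nonneg fun g _ => Finset.sum_nonneg fun h _ => hB g h, ?_⟩
  intro x hx
  unfold coqfOrigSubsidy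
  rw [Finset.sum_mul, ← Finset.sum_add_distrib]
  refine Finset.sum_le_sum fun g hg => ?_
  rw [Finset.sum_mul, ← Finset.sum_add_distrib]
  exact Finset.sum_le_sum fun h hh => hAB g h hg hh x hx
end

section
/- Fix a finite set N of agents, a collection G of social groups covering N, a group g ∈ G, and contributions c_j ≥ 0 for all agents j ∉ g. Then there exist constants A ≥ 0 and B ≥ 0 (depending only on N, G, and the fixed contributions) such that for every x ≥ 0, the CO-QF' subsidy of the profile in which every member of g contributes x and each agent outside g contributes c_j is at most A + B·√x. That is, the original Connection-Oriented Quadratic Funding subsidy grows as O(√x) even under a coordinated contribution by an entire group in G (Property 2 of the desiderata). -/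
open Finset

/-- Bound on one factor of a summand, from a bound on each agent's term. -/
lemma factor_le {N : Type*} [Fintype N] [DecidableEq N] (G : Finset (Finset N))
    (c d : N → ℝ) (p q : Finset N) (Y : ℝ) (hY : 0 ≤ Y) (hd : ∀ i, 0 ≤ d i)
    (h : ∀ i ∈ p, d i ^ ((1 : ℝ) / (kcoef G i q : ℝ)) ≤ (1 + |c i|) * Y) :
    ∑ i ∈ p, d i ^ ((1 : ℝ) / (kcoef G i q : ℝ)) / (Tset G i).card
      ≤ (∑ i, (1 + |c i|)) * Y := by
  rw [Finset.sum_mul]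
  calc _ ≤ ∑ i ∈ p, (1 + |c i|) * Y := by
        refine Finset.sum_le_sum fun i hi => le_trans ?_ (h i hi)
        have h0 : 0 ≤ d i ^ ((1 : ℝ) / (kcoef G i q : ℝ)) := Real.rpow_nonneg (hd i) _
        rcases Nat.eq_zero_or_pos (Tset G i).card with h1 | h1
        · rw [h1]; simpa using h0
        · exact div_le_self h0 (by exact_mod_cast h1)
    _ ≤ _ := Finset.sum_le_sum_of_subset_of_nonneg (Finset.subset_univ _)
        (fun i _ _ => by positivity)

lemma rpow_kcoef_le {N : Type*} [DecidableEq N] (G : Finset (Finset N)) (i : N) (q : Finset N)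
    (r : ℝ) (hr : 0 ≤ r) : r ^ ((1 : ℝ) / (kcoef G i q : ℝ)) ≤ 1 + r := by
  unfold kcoef
  split_ifs
  · simp
  · have h2 := Real.sq_sqrt hr
    have : r ^ ((1 : ℝ) / ((2 : ℕ) : ℝ)) = Real.sqrt r := by rw [Real.sqrt_eq_rpow]; norm_num
    rw [this]
    nlinarith [sq_nonneg (Real.sqrt r - 1)]

lemma rpow_kcoef_le_sqrt {N : Type*} [DecidableEq N] (G : Finset (Finset N)) (g : Finset N)
    (hg : g ∈ G) (i j : N) (hi : i ∈ g) (hj : j ∈ g) (q : Finset N) (hq : j ∈ q)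
    (r : ℝ) : r ^ ((1 : ℝ) / (kcoef G i q : ℝ)) = Real.sqrt r := by
  have : kcoef G i q = 2 := by
    unfold kcoef
    rw [if_neg]
    apply Finset.Nonempty.ne_empty
    refine ⟨g, ?_⟩
    simp only [Finset.mem_inter, Finset.mem_biUnion, Tset, Finset.mem_filter]
    exact ⟨⟨hg, hi⟩, j, hq, hg, hj⟩
  rw [this, Real.sqrt_eq_rpow]; norm_num

/-- Property 2 of the desiderata: fixing the contributions of agents outside a group `g ∈ G`,
the original CO-QF subsidy of the profile in which every member of `g` contributes `x` is
bounded by `A + B·√x` for constants `A, B ≥ 0`, i.e. it grows as `O(√x)` even under a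
coordinated contribution by an entire group in `G`. -/
theorem coqfOrig_subsidy_sqrt_in_group_contribution
    (N : Type*) [Fintype N] [DecidableEq N]
    (G : Finset (Finset N)) (hGne : ∀ g ∈ G, g.Nonempty)
    (hcover : ∀ i : N, ∃ g ∈ G, i ∈ g)
    (g : Finset N) (hgG : g ∈ G)
    (c : N → ℝ) (hc : ∀ j, j ∉ g → 0 ≤ c j) :
    ∃ A B : ℝ, 0 ≤ A ∧ 0 ≤ B ∧
      ∀ x : ℝ, 0 ≤ x →
        coqfOrigSubsidy G (fun j => if j ∈ g then x else c j) ≤ A + B * Real.sqrt x := by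
  have hS : 0 ≤ ∑ i, (1 + |c i|) := Finset.sum_nonneg fun i _ => by positivity
  set S := ∑ i, (1 + |c i|) with hSdef
  refine ⟨(G.card : ℝ) * (G.card * S), (G.card : ℝ) * (G.card * S), by positivity,
    by positivity, ?_⟩
  intro x hx
  set d : N → ℝ := fun j => if j ∈ g then x else c j with hd
  have hd0 : ∀ i, 0 ≤ d i := by
    intro i
    by_cases hi : i ∈ g
    · simpa [hd, hi] using hx
    · simpa [hd, hi] using hc i hi
  have hs := Real.sqrt_nonneg x
  have hs2 := Real.sq_sqrt hx
  set y := 1 + Real.sqrt x with hy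
  have hy1 : 1 ≤ y := by linarith
  have hy2 : y ≤ y ^ 2 := by nlinarith
  have hxy : 1 + x ≤ y ^ 2 := by rw [hy]; nlinarith
  -- the three bounds on a term
  have hout : ∀ i, i ∉ g → ∀ q, d i ^ ((1 : ℝ) / (kcoef G i q : ℝ)) ≤ 1 + |c i| := by
    intro i hi q
    refine (rpow_kcoef_le G i q _ (hd0 i)).trans ?_
    have : d i = c i := by simp [hd, hi]
    rw [this]
    linarith [le_abs_self (c i)]
  have F0 : ∀ p q, Disjoint p g →
      ∑ i ∈ p, d i ^ ((1 : ℝ) / (kcoef G i q : ℝ)) / (Tset G i).card ≤ S * 1 := by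
    intro p q hp
    refine factor_le G c d p q 1 zero_le_one hd0 fun i hi => ?_
    rw [mul_one]
    exact hout i (Finset.disjoint_left.mp hp hi) q
  have F2 : ∀ p q,
      ∑ i ∈ p, d i ^ ((1 : ℝ) / (kcoef G i q : ℝ)) / (Tset G i).card ≤ S * y ^ 2 := by
    intro p q
    refine factor_le G c d p q _ (by positivity) hd0 fun i hi => ?_
    have ha := abs_nonneg (c i)
    by_cases hig : i ∈ g
    · have h1 := rpow_kcoef_le G i q _ (hd0 i)
      have : d i = x := by simp [hd, hig]
      rw [this] at h1 ⊢
      nlinarith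
    · have := hout i hig q
      nlinarith
  have F1 : ∀ p q, ¬ Disjoint q g →
      ∑ i ∈ p, d i ^ ((1 : ℝ) / (kcoef G i q : ℝ)) / (Tset G i).card ≤ S * y := by
    intro p q hq
    obtain ⟨j, hjq, hjg⟩ := Finset.not_disjoint_iff.mp hq
    refine factor_le G c d p q _ (by positivity) hd0 fun i hi => ?_
    have ha := abs_nonneg (c i)
    by_cases hig : i ∈ g
    · rw [rpow_kcoef_le_sqrt G g hgG i j hig hjg q hjq]
      have : d i = x := by simp [hd, hig]
      rw [this]
      nlinarith
    · have := hout i hig q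
      nlinarith
  have Fnn : ∀ p q,
      0 ≤ ∑ i ∈ p, d i ^ ((1 : ℝ) / (kcoef G i q : ℝ)) / (Tset G i).card := by
    intro p q
    exact Finset.sum_nonneg fun i _ => div_nonneg (Real.rpow_nonneg (hd0 i) _) (Nat.cast_nonneg _)
  have key : ∀ p q : Finset N,
      Real.sqrt ((∑ i ∈ p, d i ^ ((1 : ℝ) / (kcoef G i q : ℝ)) / (Tset G i).card) *
        (∑ j ∈ q, d j ^ ((1 : ℝ) / (kcoef G j p : ℝ)) / (Tset G j).card)) ≤ S * y := by
    intro p q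
    apply Real.sqrt_le_iff.mpr
    refine ⟨by positivity, ?_⟩
    by_cases hp : Disjoint p g
    · calc _ ≤ (S * 1) * (S * y ^ 2) :=
            mul_le_mul (F0 p q hp) (F2 q p) (Fnn q p) (by positivity)
        _ = _ := by ring
    · by_cases hq : Disjoint q g
      · calc _ ≤ (S * y ^ 2) * (S * 1) :=
              mul_le_mul (F2 p q) (F0 q p hq) (Fnn q p) (by positivity)
          _ = _ := by ring
      · calc _ ≤ (S * y) * (S * y) :=
              mul_le_mul (F1 p q hq) (F1 q p hp) (Fnn q p) (by positivity)
          _ = _ := by ring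
  calc coqfOrigSubsidy G d ≤ ∑ p ∈ G, ∑ q ∈ G, S * y := by
        unfold coqfOrigSubsidy
        refine Finset.sum_le_sum fun p _ => Finset.sum_le_sum fun q _ => ?_
        split_ifs
        · exact key p q
        · positivity
    _ = _ := by
        simp only [Finset.sum_const, nsmul_eq_mul, hy]
        ring
end

section
/- Consider n agents where agent i has prosocial utility û_i(F) = a_i · ln(F + 1) with a_i > 0, under the direct donation mechanism F = Σ_{j=1}^n c_j. Suppose there is a unique agent p with a_p > a_i for all i ≠ p, and a_p > 1. Then the contribution profile c* with c*_p = a_p − 1 and c*_i = 0 for all i ≠ p is a Nash equilibrium; moreover, in every Nash equilibrium c of this game, c_i = 0 for all i ≠ p and c_p = a_p − 1. That is, the agent with the highest utility coefficient is the only one who donates in equilibrium. -/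
open Finset

/-- A contribution profile `c` is a Nash equilibrium of the direct donation game with utility
coefficients `a` if all contributions are nonnegative and, for every agent `i`, the
contribution `c i` maximizes `t ↦ a i * ln (t + ∑_{j ≠ i} c j + 1) − t` over `t ∈ [0, ∞)`. -/
def IsDirectDonationNash (n : ℕ) (a : Fin n → ℝ) (c : Fin n → ℝ) : Prop :=
  (∀ i, 0 ≤ c i) ∧
    ∀ i : Fin n, ∀ t : ℝ, 0 ≤ t →
      a i * Real.log (t + (∑ j ∈ Finset.univ.erase i, c j) + 1) - t
        ≤ a i * Real.log (c i + (∑ j ∈ Finset.univ.erase i, c j) + 1) - c i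

lemma log_diff_le {x y : ℝ} (hx : 0 < x) (hy : 0 < y) :
    Real.log y - Real.log x ≤ (y - x) / x := by
  have h := Real.log_le_sub_one_of_pos (div_pos hy hx)
  rw [Real.log_div hy.ne' hx.ne'] at h
  have e : (y - x) / x = y / x - 1 := by field_simp
  linarith

lemma foc {a c r : ℝ} (ha : 0 < a) (hc : 0 ≤ c) (hr : 0 ≤ r)
    (h : ∀ t : ℝ, 0 ≤ t → a * Real.log (t + r + 1) - t ≤ a * Real.log (c + r + 1) - c) :
    a ≤ c + r + 1 ∧ (0 < c → a = c + r + 1) := by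
  have key : ∀ y : ℝ, r + 1 ≤ y → a * (y - (c + r + 1)) ≤ y * (y - (c + r + 1)) := by
    intro y hy
    have hy0 : 0 < y := by linarith
    have hS : 0 < c + r + 1 := by linarith
    have h1 := h (y - r - 1) (by linarith)
    have e : y - r - 1 + r + 1 = y := by ring
    rw [e] at h1
    have h2 := log_diff_le hy0 hS
    rw [le_div_iff₀ hy0] at h2
    have h3 := mul_le_mul_of_nonneg_left h2 ha.le
    have h4 : (a * Real.log y - a * Real.log (c + r + 1)) * y ≤ (y - (c + r + 1)) * y :=
      mul_le_mul_of_nonneg_right (by linarith) hy0.le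
    linarith
  have h1 : a ≤ c + r + 1 := by
    by_contra hlt
    push Not at hlt
    have := key ((a + (c + r + 1)) / 2) (by linarith)
    have := le_of_mul_le_mul_right this (by linarith)
    linarith
  refine ⟨h1, fun hc0 => le_antisymm h1 ?_⟩
  by_contra hlt
  push Not at hlt
  have hm1 := le_max_left ((a + (c + r + 1)) / 2) (r + 1)
  have hm2 := le_max_right ((a + (c + r + 1)) / 2) (r + 1)
  have hm3 : max ((a + (c + r + 1)) / 2) (r + 1) < c + r + 1 :=
    max_lt (by linarith) (by linarith)
  have hk := key _ hm2
  nlinarith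

/-- In the direct donation game where agent `i` has utility `a i * ln (F + 1)` with `a i > 0`,
if there is a unique agent `p` whose coefficient dominates all others and `a p > 1`, then the
profile where `p` contributes `a p − 1` and everyone else contributes 0 is a Nash equilibrium,
and in every Nash equilibrium the agent `p` is the only one who donates, contributing
`a p − 1`. -/
theorem direct_donation_nash_unique_top_donor
    (n : ℕ) (a : Fin n → ℝ) (ha : ∀ i, 0 < a i)
    (p : Fin n) (hp : ∀ i, i ≠ p → a i < a p) (hap : 1 < a p) :
    IsDirectDonationNash n a (fun i => if i = p then a p - 1 else 0) ∧
    ∀ c : Fin n → ℝ, IsDirectDonationNash n a c →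
      (∀ i, i ≠ p → c i = 0) ∧ c p = a p - 1 := by
  constructor
  · refine ⟨fun i => ?_, fun i t ht => ?_⟩
    · dsimp only
      split_ifs <;> linarith
    · by_cases hi : i = p
      · subst hi
        have hs : (∑ j ∈ Finset.univ.erase i, if j = i then a i - 1 else 0) = 0 :=
          Finset.sum_eq_zero fun j hj => if_neg (Finset.ne_of_mem_erase hj)
        simp only [hs, if_true]
        have h := log_diff_le (x := a i) (y := t + 0 + 1) (ha i) (by linarith)
        rw [le_div_iff₀ (ha i)] at h
        have e : a i - 1 + 0 + 1 = a i := by ring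
        rw [e]
        linarith
      · have hs : (∑ j ∈ Finset.univ.erase i, if j = p then a p - 1 else 0) = a p - 1 := by
          rw [Finset.sum_ite_eq']
          simp [Ne.symm hi]
        simp only [hs, if_neg hi]
        have e : 0 + (a p - 1) + 1 = a p := by ring
        have e' : t + (a p - 1) + 1 = a p + t := by ring
        rw [e, e']
        have h := log_diff_le (x := a p) (y := a p + t) (ha p) (by linarith [ha p])
        have h2 := mul_le_mul_of_nonneg_left h (ha i).le
        have h3 : a i * ((a p + t - a p) / a p) ≤ t := by
          rw [← mul_div_assoc, div_le_iff₀ (ha p)]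
          nlinarith [hp i hi]
        linarith
  · rintro c ⟨hc, hN⟩
    have hsum : ∀ i, c i + (∑ j ∈ Finset.univ.erase i, c j) = ∑ j, c j := fun i =>
      Finset.add_sum_erase _ _ (Finset.mem_univ i)
    have F := fun i => foc (ha i) (hc i) (Finset.sum_nonneg fun j _ => hc j) (hN i)
    simp only [hsum] at F
    have hz : ∀ i, i ≠ p → c i = 0 := by
      intro i hi
      by_contra hne
      have h1 := (F i).2 (lt_of_le_of_ne (hc i) (Ne.symm hne))
      linarith [(F p).1, hp i hi]
    refine ⟨hz, ?_⟩
    have hS : ∑ j, c j = c p :=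
      Finset.sum_eq_single p (fun j _ hj => hz j hj) (fun h => absurd (Finset.mem_univ p) h)
    rw [hS] at F
    have := (F p).2 (by linarith [(F p).1])
    linarith
end
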